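/- Let p ≥ 2 be an integer and let α ∈ (1,2) with p > α. Then f^{p,α}(θ) ≥ 0 for all θ ∈ [-π,π], f^{p,α}(θ) = 0 if and only if θ = 0, and f^{p,α} has a zero of order α at θ = 0: there exist constants c₁, c₂ > 0 such that c₁ |θ|^α ≤ f^{p,α}(θ) ≤ c₂ |θ|^α for all θ ∈ [-π,π]. -/

import Mathlib

open MeasureTheory

/-- `sin x / x` with value 1 at 0. -/
noncomputable def sincf (x : ℝ) : ℝ := if x = 0 then 1 else Real.sin x / x

/-- The symbol `f^{p,α}`. -/
noncomputable def fSymbol (p : ℕ) (α : ℝ) (θ : ℝ) : ℝ :=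
  ∑' l : ℤ, |θ + 2 * (l : ℝ) * Real.pi| ^ α * sincf (θ / 2 + (l : ℝ) * Real.pi) ^ (p + 1)

lemma sincf_neg' (x : ℝ) : sincf (-x) = sincf x := by
  unfold sincf
  by_cases h : x = 0
  · simp [h]
  · simp [h, Real.sin_neg, neg_div_neg_eq]

lemma fSymbol_neg' (p : ℕ) (α θ : ℝ) : fSymbol p α (-θ) = fSymbol p α θ := by
  unfold fSymbol
  rw [← (Equiv.neg ℤ).tsum_eq]
  apply tsum_congr
  intro l
  have e1 : -θ + 2 * (((Equiv.neg ℤ) l : ℤ) : ℝ) * Real.pi = -(θ + 2 * (l : ℝ) * Real.pi) := by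
    simp; ring
  have e2 : -θ / 2 + (((Equiv.neg ℤ) l : ℤ) : ℝ) * Real.pi = -(θ / 2 + (l : ℝ) * Real.pi) := by
    simp; ring
  rw [e1, e2, abs_neg, sincf_neg']

lemma fSymbol_zero' (p : ℕ) (α : ℝ) (h1 : 1 < α) : fSymbol p α 0 = 0 := by
  unfold fSymbol
  rw [← tsum_zero (α := ℝ) (β := ℤ)]
  apply tsum_congr
  intro l
  by_cases hl : l = 0
  · subst hl
    simp [Real.zero_rpow (by linarith : α ≠ 0)]
  · have : (l : ℝ) * Real.pi ≠ 0 := mul_ne_zero (by exact_mod_cast hl) Real.pi_ne_zero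
    simp [sincf, hl, Real.sin_int_mul_pi]

lemma term_eq (p : ℕ) (α y : ℝ) (hy : 0 < y) (n : ℕ) :
    |2 * (y + n * Real.pi)| ^ α * sincf (y + n * Real.pi) ^ (p + 1)
      = (2 ^ α * Real.sin y ^ (p + 1)) * (((-1) ^ (p + 1)) ^ n *
        (y + n * Real.pi) ^ (-((p : ℝ) + 1 - α))) := by
  have hpos : 0 < y + n * Real.pi := by positivity
  rw [abs_of_pos (by positivity), sincf, if_neg hpos.ne', Real.sin_add_nat_mul_pi,
    Real.mul_rpow (by norm_num) hpos.le,
    show -((p : ℝ) + 1 - α) = α - ((p + 1 : ℕ) : ℝ) by push_cast; ring,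
    Real.rpow_sub hpos, Real.rpow_natCast, div_pow, mul_pow, ← pow_mul, ← pow_mul, mul_comm n]
  ring

lemma bound_aux (β x y : ℝ) (hβ : 1 < β) (hx : 0 < x) (hxy : x ≤ y) (hxp : x ≤ Real.pi) (n : ℕ) :
    (y + n * Real.pi) ^ (-β) ≤ x ^ (-β) * ((n : ℝ) + 1) ^ (-β) := by
  rw [← Real.mul_rpow hx.le (by positivity)]
  apply Real.rpow_le_rpow_of_nonpos (by positivity)
  · nlinarith [mul_le_mul_of_nonneg_left hxp (Nat.cast_nonneg n : (0:ℝ) ≤ n)]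
  · linarith

lemma summable_aux (β : ℝ) (hβ : 1 < β) : Summable (fun n : ℕ => ((n : ℝ) + 1) ^ (-β)) := by
  have := (summable_nat_add_iff 1).mpr (Real.summable_nat_rpow.mpr (by linarith : -β < -1))
  simpa using this

lemma half_aux (β ε x y : ℝ) (hβ : 1 < β) (hε : ε = 1 ∨ ε = -1) (hx : 0 < x) (hxy : x ≤ y)
    (hxp : x ≤ Real.pi) :
    Summable (fun n : ℕ => ε ^ n * (y + n * Real.pi) ^ (-β)) ∧
    (y ^ (-β) - (y + Real.pi) ^ (-β) ≤ ∑' n : ℕ, ε ^ n * (y + n * Real.pi) ^ (-β)) ∧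
    (∑' n : ℕ, ε ^ n * (y + n * Real.pi) ^ (-β) ≤ x ^ (-β) * ∑' n : ℕ, ((n : ℝ) + 1) ^ (-β)) := by
  have hy : 0 < y := hx.trans_le hxy
  have hb := bound_aux β x y hβ hx hxy hxp
  have hs := (summable_aux β hβ).mul_left (x ^ (-β))
  have hnn : ∀ n : ℕ, 0 ≤ (y + n * Real.pi) ^ (-β) := fun n => by positivity
  have habs : ∀ n : ℕ, |ε ^ n| = 1 := by
    intro n
    rcases hε with h | h <;> simp [h]
  have hS : Summable (fun n : ℕ => ε ^ n * (y + n * Real.pi) ^ (-β)) := by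
    refine Summable.of_norm_bounded hs ?_
    intro n
    rw [Real.norm_eq_abs, abs_mul, habs, one_mul, abs_of_nonneg (hnn n)]
    exact hb n
  refine ⟨hS, ?_, ?_⟩
  · rcases hε with h | h
    · subst h
      have h0 := hS.sum_le_tsum {0} (fun n _ => by simpa using hnn n)
      simp only [Finset.sum_singleton] at h0
      have h1 := hnn 1
      simp at h0 h1
      simp
      linarith
    · subst h
      have ha : Antitone (fun n : ℕ => (y + n * Real.pi) ^ (-β)) := by
        intro m n hmn
        have : (m : ℝ) ≤ n := by exact_mod_cast hmn
        apply Real.rpow_le_rpow_of_nonpos (by positivity)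
        · have := Real.pi_pos
          gcongr
        · linarith
      have := ha.alternating_series_le_tendsto hS.hasSum.tendsto_sum_nat 1
      simp [Finset.sum_range_succ] at this
      linarith
  · rw [← tsum_mul_left]
    refine hS.tsum_le_tsum (fun n => ?_) hs
    refine le_trans ?_ (hb n)
    have : ε ^ n ≤ 1 := (le_abs_self _).trans (habs n).le
    nlinarith [hnn n]

lemma key (p : ℕ) (α : ℝ) (h1 : 1 < α) (hpα : α < p) (θ : ℝ) (h0 : 0 < θ) (hθ : θ ≤ Real.pi) :
    (2 / Real.pi) ^ (p + 1) * (2 / 3) * θ ^ α ≤ fSymbol p α θ ∧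
    fSymbol p α θ ≤ 2 * (∑' n : ℕ, ((n : ℝ) + 1) ^ (-((p : ℝ) + 1 - α))) * θ ^ α := by
  obtain ⟨x, rfl⟩ : ∃ x, θ = 2 * x := ⟨θ / 2, by ring⟩
  have hx : 0 < x := by linarith
  have hpi := Real.pi_pos
  set β : ℝ := (p : ℝ) + 1 - α with hβdef
  have hβ : 1 < β := by linarith
  set ε : ℝ := (-1) ^ (p + 1) with hεdef
  have hε : ε = 1 ∨ ε = -1 := neg_one_pow_eq_or ℝ (p + 1)
  set K : ℝ := 2 ^ α * Real.sin x ^ (p + 1) with hK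
  have hsin : 0 < Real.sin x := Real.sin_pos_of_pos_of_lt_pi hx (by linarith)
  have hKpos : 0 < K := by positivity
  obtain ⟨s1, l1, u1⟩ := half_aux β ε x x hβ hε hx le_rfl (by linarith)
  obtain ⟨s2, l2, u2⟩ := half_aux β ε x (Real.pi - x) hβ hε hx (by linarith) (by linarith)
  have hf : fSymbol p α (2 * x) = K * (∑' n : ℕ, ε ^ n * (x + n * Real.pi) ^ (-β))
      + K * (∑' n : ℕ, ε ^ n * ((Real.pi - x) + n * Real.pi) ^ (-β)) := by
    unfold fSymbol
    refine HasSum.tsum_eq (HasSum.of_nat_of_neg_add_one ?_ ?_)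
    · refine Eq.mp (congrArg (fun g => HasSum g _) ?_) (s1.hasSum.mul_left K)
      funext n
      symm
      rw [← term_eq p α x hx n]
      push_cast
      congr 2
      · congr 1; ring
      · congr 1; ring
    · refine Eq.mp (congrArg (fun g => HasSum g _) ?_) (s2.hasSum.mul_left K)
      funext n
      symm
      have := term_eq p α (Real.pi - x) (by linarith) n
      rw [Real.sin_pi_sub] at this
      rw [← this]
      push_cast
      rw [← abs_neg, ← sincf_neg']
      congr 2
      · congr 1; ring
      · congr 1; ring
  have hKx : K * x ^ (-β) = (2 * x) ^ α * (Real.sin x / x) ^ (p + 1) := by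
    rw [hK, show -β = α - ((p + 1 : ℕ) : ℝ) by push_cast; ring,
      Real.rpow_sub hx, Real.rpow_natCast, div_pow, Real.mul_rpow (by norm_num) hx.le]
    ring
  have hA : 0 ≤ (2 * x) ^ α := by positivity
  have hB : 0 ≤ x ^ (-β) := by positivity
  rw [hf]
  constructor
  · have q1 : (x + Real.pi) ^ (-β) ≤ 1 / 3 * x ^ (-β) := by
      have : (x + Real.pi) ^ (-β) ≤ (3 * x) ^ (-β) :=
        Real.rpow_le_rpow_of_nonpos (by positivity) (by linarith) (by linarith)
      rw [Real.mul_rpow (by norm_num) hx.le] at this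
      have h3 : (3 : ℝ) ^ (-β) ≤ 3 ^ (-1 : ℝ) :=
        Real.rpow_le_rpow_of_exponent_le (by norm_num) (by linarith)
      rw [Real.rpow_neg_one] at h3
      nlinarith
    have q2 : (Real.pi - x + Real.pi) ^ (-β) ≤ (Real.pi - x) ^ (-β) :=
      Real.rpow_le_rpow_of_nonpos (by linarith) (by linarith) (by linarith)
    have q3 : 2 / Real.pi ≤ Real.sin x / x := by
      rw [le_div_iff₀ hx]
      exact Real.mul_le_sin hx.le (by linarith)
    have q4 : (2 / Real.pi) ^ (p + 1) ≤ (Real.sin x / x) ^ (p + 1) :=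
      pow_le_pow_left₀ (by positivity) q3 _
    have q5 : K * (2 / 3 * x ^ (-β)) ≤ K * (∑' n : ℕ, ε ^ n * (x + n * Real.pi) ^ (-β)) :=
      mul_le_mul_of_nonneg_left (by linarith) hKpos.le
    have q6 : 0 ≤ K * (∑' n : ℕ, ε ^ n * ((Real.pi - x) + n * Real.pi) ^ (-β)) :=
      mul_nonneg hKpos.le (by linarith)
    have q7 := mul_le_mul_of_nonneg_left q4 hA
    nlinarith
  · have r1 : (Real.sin x / x) ^ (p + 1) ≤ 1 :=
      pow_le_one₀ (by positivity) (by rw [div_le_one hx]; exact Real.sin_le hx.le)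
    have r2 : K * x ^ (-β) ≤ (2 * x) ^ α := by
      rw [hKx]; nlinarith
    have r3 : 0 ≤ ∑' n : ℕ, ((n : ℝ) + 1) ^ (-β) := tsum_nonneg fun n => by positivity
    have t1 := mul_le_mul_of_nonneg_left u1 hKpos.le
    have t2 := mul_le_mul_of_nonneg_left u2 hKpos.le
    have t3 := mul_le_mul_of_nonneg_right r2 r3
    nlinarith

theorem stmt9 (p : ℕ) (hp : 2 ≤ p) (α : ℝ) (h1 : 1 < α) (h2 : α < 2) (hpα : α < p) :
    (∀ θ ∈ Set.Icc (-Real.pi) Real.pi, 0 ≤ fSymbol p α θ) ∧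
    (∀ θ ∈ Set.Icc (-Real.pi) Real.pi, (fSymbol p α θ = 0 ↔ θ = 0)) ∧
    (∃ c₁ > (0 : ℝ), ∃ c₂ > (0 : ℝ), ∀ θ ∈ Set.Icc (-Real.pi) Real.pi,
      c₁ * |θ| ^ α ≤ fSymbol p α θ ∧ fSymbol p α θ ≤ c₂ * |θ| ^ α) := by
  have hpi := Real.pi_pos
  have hc₁ : 0 < (2 / Real.pi) ^ (p + 1) * (2 / 3) := by positivity
  have main : ∀ θ ∈ Set.Icc (-Real.pi) Real.pi,
      (2 / Real.pi) ^ (p + 1) * (2 / 3) * |θ| ^ α ≤ fSymbol p α θ ∧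
      fSymbol p α θ ≤ 2 * (∑' n : ℕ, ((n : ℝ) + 1) ^ (-((p : ℝ) + 1 - α))) * |θ| ^ α := by
    intro θ hθ
    have e : fSymbol p α θ = fSymbol p α |θ| := by
      rcases abs_choice θ with h | h <;> rw [h]
      rw [fSymbol_neg']
    rw [e]
    rcases (abs_nonneg θ).eq_or_lt with h | h
    · rw [← h, fSymbol_zero' p α h1, Real.zero_rpow (by linarith)]
      simp
    · exact key p α h1 hpα |θ| h (abs_le.mpr hθ)
  refine ⟨fun θ hθ => le_trans (by positivity) (main θ hθ).1, fun θ hθ => ⟨fun h => ?_, ?_⟩,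
    _, hc₁, _, ?_, main⟩
  · by_contra hne
    have := (main θ hθ).1
    rw [h] at this
    have h3 : 0 < |θ| ^ α := Real.rpow_pos_of_pos (abs_pos.mpr hne) _
    nlinarith [mul_pos hc₁ h3]
  · rintro rfl
    exact fSymbol_zero' p α h1
  · have := (summable_aux ((p : ℝ) + 1 - α) (by linarith)).tsum_pos
      (fun n => by positivity) 0 (by positivity)
    linarith
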